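/- arXiv:2302.03522 — 7 statements merged into one kernel-verified Lean document; each statement's English description precedes it below -/
import Mathlib

section
/- Let 𝒟 be a pre-Dynkin-system on a set Ω. Then 𝒟 is the union of its maximal subalgebras: every A ∈ 𝒟 is contained in some algebra of sets 𝒜 with 𝒜 ⊆ 𝒟 that is maximal (with respect to set inclusion) among algebras of sets contained in 𝒟; consequently 𝒟 equals the union of the family of all maximal algebras of sets contained in 𝒟. -/
/-- A pre-Dynkin-system on `Ω`: contains `∅`, closed under complement and disjoint union. -/
def IsPreDynkin {Ω : Type*} (𝒟 : Set (Set Ω)) : Prop :=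
  ∅ ∈ 𝒟 ∧ (∀ A ∈ 𝒟, Aᶜ ∈ 𝒟) ∧ ∀ A ∈ 𝒟, ∀ B ∈ 𝒟, A ∩ B = ∅ → A ∪ B ∈ 𝒟

/-- An algebra of sets on `Ω`: contains `∅`, closed under complement and finite unions. -/
def IsSetAlgebra' {Ω : Type*} (𝒜 : Set (Set Ω)) : Prop :=
  ∅ ∈ 𝒜 ∧ (∀ A ∈ 𝒜, Aᶜ ∈ 𝒜) ∧ ∀ A ∈ 𝒜, ∀ B ∈ 𝒜, A ∪ B ∈ 𝒜

/-- A pre-Dynkin-system is the union of its maximal subalgebras. -/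
theorem preDynkin_eq_sUnion_maximal_algebras {Ω : Type*} (𝒟 : Set (Set Ω))
    (h𝒟 : IsPreDynkin 𝒟) :
    (∀ A ∈ 𝒟, ∃ 𝒜 : Set (Set Ω),
        (IsSetAlgebra' 𝒜 ∧ 𝒜 ⊆ 𝒟 ∧
          ∀ ℬ : Set (Set Ω), IsSetAlgebra' ℬ → ℬ ⊆ 𝒟 → 𝒜 ⊆ ℬ → ℬ = 𝒜) ∧ A ∈ 𝒜) ∧
    𝒟 = ⋃₀ {𝒜 : Set (Set Ω) | IsSetAlgebra' 𝒜 ∧ 𝒜 ⊆ 𝒟 ∧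
          ∀ ℬ : Set (Set Ω), IsSetAlgebra' ℬ → ℬ ⊆ 𝒟 → 𝒜 ⊆ ℬ → ℬ = 𝒜} := by
  have main : ∀ A ∈ 𝒟, ∃ 𝒜 : Set (Set Ω),
        (IsSetAlgebra' 𝒜 ∧ 𝒜 ⊆ 𝒟 ∧
          ∀ ℬ : Set (Set Ω), IsSetAlgebra' ℬ → ℬ ⊆ 𝒟 → 𝒜 ⊆ ℬ → ℬ = 𝒜) ∧ A ∈ 𝒜 := by
    intro A hA
    obtain ⟨h0, hc, -⟩ := h𝒟
    have hu : Set.univ ∈ 𝒟 := by simpa using hc _ h0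
    have hx : ({∅, Set.univ, A, Aᶜ} : Set (Set Ω)) ∈
        {𝒜 : Set (Set Ω) | IsSetAlgebra' 𝒜 ∧ 𝒜 ⊆ 𝒟} := by
      refine ⟨⟨by simp, ?_, ?_⟩, ?_⟩
      · rintro B (rfl | rfl | rfl | rfl) <;> simp
      · rintro B (rfl | rfl | rfl | rfl) C (rfl | rfl | rfl | rfl) <;> simp
      · rintro B (rfl | rfl | rfl | rfl)
        exacts [h0, hu, hA, hc _ hA]
    obtain ⟨m, hm, hmax⟩ := zorn_subset_nonempty
      {𝒜 : Set (Set Ω) | IsSetAlgebra' 𝒜 ∧ 𝒜 ⊆ 𝒟} (by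
        intro c hcS hchain ⟨y, hy⟩
        refine ⟨⋃₀ c, ⟨⟨⟨y, hy, (hcS hy).1.1⟩, ?_, ?_⟩, ?_⟩,
          fun s hs => Set.subset_sUnion_of_mem hs⟩
        · rintro B ⟨t, ht, hB⟩
          exact ⟨t, ht, (hcS ht).1.2.1 _ hB⟩
        · rintro B ⟨t, ht, hB⟩ C ⟨u, hu, hC⟩
          rcases hchain.total ht hu with h | h
          · exact ⟨u, hu, (hcS hu).1.2.2 _ (h hB) _ hC⟩
          · exact ⟨t, ht, (hcS ht).1.2.2 _ hB _ (h hC)⟩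
        · exact Set.sUnion_subset fun t ht => (hcS ht).2) _ hx
    refine ⟨m, ⟨hmax.prop.1, hmax.prop.2, ?_⟩, hm (by simp)⟩
    intro ℬ h1 h2 h3
    exact Set.Subset.antisymm (hmax.2 ⟨h1, h2⟩ h3) h3
  refine ⟨main, Set.Subset.antisymm ?_ (Set.sUnion_subset fun t ht => ht.2.1)⟩
  intro A hA
  obtain ⟨𝒜, h, hA'⟩ := main A hA
  exact ⟨𝒜, h, hA'⟩
end

section
/- Let ℓ : 2^Ω → [0,1] and u : 2^Ω → [0,1] be set functions satisfying: (a) u(∅) = ℓ(∅) = 0; (b) u(A) = 1 − ℓ(Ω∖A) for all A ⊆ Ω; (c) u(A ∪ B) ≤ u(A) + u(B) for all disjoint A, B ⊆ Ω; (d) ℓ(A ∪ B) ≥ ℓ(A) + ℓ(B) for all disjoint A, B ⊆ Ω. Then the set 𝒟 = {A ⊆ Ω : ℓ(A) = u(A)} is a pre-Dynkin-system on Ω, and the common restriction μ = u|𝒟 = ℓ|𝒟 is a finitely additive probability on 𝒟. -/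
/-- A finitely additive probability on a pre-Dynkin-system `𝒟` (modelled as a function on
all sets whose relevant properties hold on `𝒟`): values in `[0,1]`, `μ ∅ = 0`, `μ Ω = 1`,
and additivity for disjoint members of `𝒟`. -/
def IsFinAddProbOn {Ω : Type*} (𝒟 : Set (Set Ω)) (μ : Set Ω → ℝ) : Prop :=
  (∀ A ∈ 𝒟, 0 ≤ μ A ∧ μ A ≤ 1) ∧ μ ∅ = 0 ∧ μ Set.univ = 1 ∧
    ∀ A ∈ 𝒟, ∀ B ∈ 𝒟, A ∩ B = ∅ → μ (A ∪ B) = μ A + μ B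

/-- a conjugate, normalized pair of a superadditive lower and subadditive upper
probability coincides on a pre-Dynkin-system, on which it is a finitely additive probability. -/
theorem imprecise_prob_induces_preDynkin {Ω : Type*} (ℓ u : Set Ω → ℝ)
    (hℓ01 : ∀ A : Set Ω, 0 ≤ ℓ A ∧ ℓ A ≤ 1)
    (hu01 : ∀ A : Set Ω, 0 ≤ u A ∧ u A ≤ 1)
    (ha : u ∅ = 0 ∧ ℓ ∅ = 0)
    (hb : ∀ A : Set Ω, u A = 1 - ℓ Aᶜ)
    (hc : ∀ A B : Set Ω, A ∩ B = ∅ → u (A ∪ B) ≤ u A + u B)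
    (hd : ∀ A B : Set Ω, A ∩ B = ∅ → ℓ (A ∪ B) ≥ ℓ A + ℓ B) :
    IsPreDynkin {A : Set Ω | ℓ A = u A} ∧
    IsFinAddProbOn {A : Set Ω | ℓ A = u A} u ∧
    IsFinAddProbOn {A : Set Ω | ℓ A = u A} ℓ := by
  have hle : ∀ A : Set Ω, ℓ A ≤ u A := by
    intro A
    have h1 := hd A Aᶜ (Set.inter_compl_self A)
    have h2 := (hℓ01 (A ∪ Aᶜ)).2
    have h3 := hb A
    linarith
  have hℓuniv : ℓ Set.univ = 1 := by
    have h := hb ∅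
    rw [Set.compl_empty] at h
    linarith [ha.1]
  have huuniv : u Set.univ = 1 := by
    have h := hb Set.univ
    rw [Set.compl_univ] at h
    linarith [ha.2]
  refine ⟨⟨?_, ?_, ?_⟩, ⟨fun A _ => hu01 A, ha.1, huuniv, ?_⟩,
    ⟨fun A _ => hℓ01 A, ha.2, hℓuniv, ?_⟩⟩
  · exact ha.2.trans ha.1.symm
  · intro A hA
    have hA' : ℓ A = u A := hA
    change ℓ Aᶜ = u Aᶜ
    have h1 := hb A
    have h2 := hb Aᶜ
    rw [compl_compl] at h2
    linarith
  all_goals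
    intro A hA B hB hAB
    have hA' : ℓ A = u A := hA
    have hB' : ℓ B = u B := hB
    have h1 := hc A B hAB
    have h2 := hd A B hAB
    have h3 := hle (A ∪ B)
    try change ℓ (A ∪ B) = u (A ∪ B)
    linarith
end

section
/- Let ℓ : 2^Ω → [0,1] and u : 2^Ω → [0,1] be set functions satisfying: (a) u(∅) = ℓ(∅) = 0; (b) u(A) = 1 − ℓ(Ω∖A) for all A ⊆ Ω; (c) u(A ∪ B) ≤ u(A) + u(B) for all disjoint A, B ⊆ Ω; (d) ℓ(A ∪ B) ≥ ℓ(A) + ℓ(B) for all disjoint A, B ⊆ Ω; and moreover u is continuous from below (if A_n ⊆ A_{n+1} for all n and ⋃_n A_n = A, then lim_{n→∞} u(A_n) = u(A)). Then 𝒟_σ = {A ⊆ Ω : ℓ(A) = u(A)} is a Dynkin-system on Ω, and the common restriction μ_σ = u|𝒟_σ = ℓ|𝒟_σ is a countably additive probability on 𝒟_σ, i.e. μ_σ(⋃_{i∈I} A_i) = Σ_{i∈I} μ_σ(A_i) for every countable pairwise-disjoint family {A_i}_{i∈I} ⊆ 𝒟_σ. -/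
/-- A Dynkin-system on `Ω`: contains `∅`, closed under complement and countable
pairwise-disjoint unions. -/
def IsDynkin {Ω : Type*} (𝒟 : Set (Set Ω)) : Prop :=
  ∅ ∈ 𝒟 ∧ (∀ A ∈ 𝒟, Aᶜ ∈ 𝒟) ∧
    ∀ A : ℕ → Set Ω, (∀ i, A i ∈ 𝒟) → (∀ i j, i ≠ j → A i ∩ A j = ∅) → (⋃ i, A i) ∈ 𝒟

/-- with continuity from below of `u` in addition, the system of precision
is a Dynkin-system and the common restriction is a countably additive probability on it. -/
theorem imprecise_prob_induces_dynkin {Ω : Type*} (ℓ u : Set Ω → ℝ)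
    (hℓ01 : ∀ A : Set Ω, 0 ≤ ℓ A ∧ ℓ A ≤ 1)
    (hu01 : ∀ A : Set Ω, 0 ≤ u A ∧ u A ≤ 1)
    (ha : u ∅ = 0 ∧ ℓ ∅ = 0)
    (hb : ∀ A : Set Ω, u A = 1 - ℓ Aᶜ)
    (hc : ∀ A B : Set Ω, A ∩ B = ∅ → u (A ∪ B) ≤ u A + u B)
    (hd : ∀ A B : Set Ω, A ∩ B = ∅ → ℓ (A ∪ B) ≥ ℓ A + ℓ B)
    (he : ∀ A : ℕ → Set Ω, (∀ n, A n ⊆ A (n + 1)) →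
      Filter.Tendsto (fun n => u (A n)) Filter.atTop (nhds (u (⋃ n, A n)))) :
    IsDynkin {A : Set Ω | ℓ A = u A} ∧
    (∀ A ∈ {A : Set Ω | ℓ A = u A}, ℓ A = u A ∧ 0 ≤ u A ∧ u A ≤ 1) ∧
    u ∅ = 0 ∧ u Set.univ = 1 ∧
    -- countable additivity: for every countable pairwise-disjoint family `{A i}_{i ∈ I}`,
    -- `I ⊆ ℕ`, of members of the system of precision
    (∀ (I : Set ℕ) (A : ℕ → Set Ω), (∀ i ∈ I, A i ∈ {A : Set Ω | ℓ A = u A}) →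
      (∀ i ∈ I, ∀ j ∈ I, i ≠ j → A i ∩ A j = ∅) →
      u (⋃ i ∈ I, A i) = ∑' i : I, u (A i)) := by
  have huniv : u Set.univ = 1 := by rw [hb, Set.compl_univ, ha.2]; norm_num
  have hle : ∀ A, ℓ A ≤ u A := by
    intro A
    have h1 := hd A Aᶜ (Set.inter_compl_self A)
    have h2 := (hℓ01 (A ∪ Aᶜ)).2
    have h3 := hb A
    linarith
  have hmono : ∀ A B, A ⊆ B → ℓ A ≤ ℓ B := by
    intro A B h
    have h1 := hd A (B \ A) (Set.inter_sdiff_self A B)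
    rw [Set.union_sdiff_cancel h] at h1
    have h2 := (hℓ01 (B \ A)).1
    linarith
  have key : ∀ A : ℕ → Set Ω, (∀ i, ℓ (A i) = u (A i)) → (∀ i j, i ≠ j → A i ∩ A j = ∅) →
      ℓ (⋃ i, A i) = u (⋃ i, A i) ∧ HasSum (fun i => u (A i)) (u (⋃ i, A i)) := by
    intro A hA hdis
    let S : ℕ → Set Ω := fun n => ⋃ i, ⋃ (_ : i < n), A i
    have hS0 : S 0 = ∅ := by simp [S]
    have hSs : ∀ n, S (n + 1) = S n ∪ A n := by
      intro n
      ext x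
      simp only [S, Set.mem_iUnion, Set.mem_union, exists_prop]
      constructor
      · rintro ⟨i, hi, hx⟩
        rcases Nat.lt_succ_iff_lt_or_eq.1 hi with h | h
        · exact Or.inl ⟨i, h, hx⟩
        · exact Or.inr (h ▸ hx)
      · rintro (⟨i, hi, hx⟩ | hx)
        · exact ⟨i, by omega, hx⟩
        · exact ⟨n, by omega, hx⟩
    have hSd : ∀ n, S n ∩ A n = ∅ := by
      intro n
      ext x
      simp only [S, Set.mem_inter_iff, Set.mem_iUnion, exists_prop, Set.mem_empty_iff_false,
        iff_false]
      rintro ⟨⟨i, hi, hx⟩, hx2⟩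
      have h : x ∈ A i ∩ A n := ⟨hx, hx2⟩
      rw [hdis i n hi.ne] at h
      exact h
    have hSU : (⋃ n, S n) = ⋃ i, A i := by
      ext x
      simp only [S, Set.mem_iUnion, exists_prop]
      constructor
      · rintro ⟨n, i, _, hx⟩
        exact ⟨i, hx⟩
      · rintro ⟨i, hx⟩
        exact ⟨i + 1, i, by omega, hx⟩
    have hfin : ∀ n, ℓ (S n) = u (S n) ∧ u (S n) = ∑ i ∈ Finset.range n, u (A i) := by
      intro n
      induction n with
      | zero => rw [hS0]; simp [ha.1, ha.2]
      | succ n ih =>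
        rw [hSs, Finset.sum_range_succ]
        have h1 := hd _ _ (hSd n)
        have h2 := hc _ _ (hSd n)
        have h3 := hle (S n ∪ A n)
        have h4 := hA n
        obtain ⟨h5, h6⟩ := ih
        constructor <;> linarith
    have hlim := he S (fun n => by rw [hSs]; exact Set.subset_union_left)
    rw [hSU] at hlim
    constructor
    · apply le_antisymm (hle _)
      refine le_of_tendsto' hlim (fun n => ?_)
      rw [← (hfin n).1]
      apply hmono
      rw [← hSU]
      exact Set.subset_iUnion S n
    · rw [hasSum_iff_tendsto_nat_of_nonneg (fun i => (hu01 _).1)]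
      exact hlim.congr (fun n => (hfin n).2)
  refine ⟨⟨?_, ?_, ?_⟩, ?_, ha.1, huniv, ?_⟩
  · simp [ha.1, ha.2]
  · intro A hA
    have h0 : ℓ A = u A := hA
    have h1 := hb A
    have h2 := hb Aᶜ
    rw [compl_compl] at h2
    change ℓ Aᶜ = u Aᶜ
    linarith
  · intro A hA hdis
    exact (key A hA hdis).1
  · intro A hA
    exact ⟨hA, hu01 A⟩
  · intro I A hA hdis
    have hk := (key (fun i => ⋃ (_ : i ∈ I), A i) (by
      intro i
      by_cases hi : i ∈ I
      · simpa [hi] using hA i hi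
      · simp [hi, ha.1, ha.2]) (by
      intro i j hij
      by_cases hi : i ∈ I
      · by_cases hj : j ∈ I
        · simpa [hi, hj] using hdis i hi j hj hij
        · simp [hj]
      · simp [hi])).2
    rw [← hk.tsum_eq, tsum_subtype I (fun i => u (A i))]
    congr 1
    ext i
    by_cases hi : i ∈ I
    · simp [hi]
    · simp [hi, ha.1]
end

section
/- Let 𝒟 be a pre-Dynkin-system on Ω and μ a finitely additive probability on 𝒟. Then μ is extendable to 2^Ω (i.e., there exists a finitely additive probability ν on 2^Ω with ν|𝒟 = μ) if and only if μ is a coherent additive probability on 𝒟, namely: μ(A) = 1 − μ(Ω∖A) for all A ∈ 𝒟, and for all nonnegative integers n, m and all A_0, A_1, …, A_n ∈ 𝒟 one has sup_{ω∈Ω} [ Σ_{i=1}^{n} (χ_{A_i}(ω) − μ(A_i)) − m·(χ_{A_0}(ω) − μ(A_0)) ] ≥ 0, where χ_A denotes the indicator function of A. -/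
/-- A finitely additive probability on all of `2^Ω`. -/
def IsFinAddProb {Ω : Type*} (ν : Set Ω → ℝ) : Prop :=
  (∀ A : Set Ω, 0 ≤ ν A ∧ ν A ≤ 1) ∧ ν ∅ = 0 ∧ ν Set.univ = 1 ∧
    ∀ A B : Set Ω, A ∩ B = ∅ → ν (A ∪ B) = ν A + ν B

open Classical in
theorem ficoh_integral {Ω : Type*} (ν : Set Ω → ℝ) (hν : IsFinAddProb ν) {ι : Type*}
    (A : ι → Set Ω) (c : ι → ℝ) (S : Finset ι) : ∀ (B : Set Ω) (K : ℝ),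
    (∀ ω ∈ B, ∑ i ∈ S, c i * Set.indicator (A i) (1 : Ω → ℝ) ω ≤ K) →
    ∑ i ∈ S, c i * ν (A i ∩ B) ≤ K * ν B := by
  obtain ⟨h01, h0, h1, hadd⟩ := hν
  have split : ∀ B C : Set Ω, ν B = ν (B ∩ C) + ν (B \ C) := by
    intro B C
    rw [← hadd _ _ (by ext x; simp; tauto), Set.inter_union_sdiff]
  induction S using Finset.induction_on with
  | empty =>
    intro B K h
    rcases B.eq_empty_or_nonempty with rfl | ⟨ω, hω⟩
    · simp [h0]
    · have := h ω hω
      simp only [Finset.sum_empty] at this ⊢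
      exact mul_nonneg this (h01 B).1
  | insert a S ha ih =>
    intro B K h
    have e1 := ih (B ∩ A a) (K - c a) (by
      intro ω hω
      have := h ω hω.1
      rw [Finset.sum_insert ha, Set.indicator_of_mem hω.2] at this
      simp only [Pi.one_apply] at this
      linarith)
    have e2 := ih (B \ A a) K (by
      intro ω hω
      have := h ω hω.1
      rw [Finset.sum_insert ha, Set.indicator_of_notMem hω.2] at this
      linarith)
    have e3 : ∑ i ∈ S, c i * ν (A i ∩ B) = ∑ i ∈ S, c i * ν (A i ∩ (B ∩ A a)) +
        ∑ i ∈ S, c i * ν (A i ∩ (B \ A a)) := by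
      rw [← Finset.sum_add_distrib]
      refine Finset.sum_congr rfl fun i _ => ?_
      rw [split (A i ∩ B) (A a), Set.inter_assoc, Set.inter_sdiff_assoc]
      ring
    rw [Finset.sum_insert ha, e3, split B (A a), Set.inter_comm (A a) B]
    linarith

theorem ficoh_nat {Ω : Type*} (𝒟 : Set (Set Ω)) (μ : Set Ω → ℝ)
    (H : ∀ (n m : ℕ) (A : Fin n → Set Ω) (A₀ : Set Ω),
          (∀ i, A i ∈ 𝒟) → A₀ ∈ 𝒟 → ∀ ε : ℝ, 0 < ε → ∃ ω : Ω,
            (∑ i : Fin n, (Set.indicator (A i) (1 : Ω → ℝ) ω - μ (A i))) -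
              (m : ℝ) * (Set.indicator A₀ (1 : Ω → ℝ) ω - μ A₀) > -ε)
    (h0 : ∅ ∈ 𝒟) {ι : Type*} [Fintype ι] (A : ι → Set Ω) (hA : ∀ i, A i ∈ 𝒟) (k : ι → ℕ)
    (ε : ℝ) (hε : 0 < ε) : ∃ ω : Ω,
      ∑ i, (k i : ℝ) * (Set.indicator (A i) (1 : Ω → ℝ) ω - μ (A i)) > -ε := by
  let e := (Fintype.equivFin (Σ i : ι, Fin (k i))).symm
  obtain ⟨ω, hω⟩ := H _ 0 (fun j => A (e j).1) ∅ (fun j => hA _) h0 ε hε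
  refine ⟨ω, ?_⟩
  rw [e.sum_comp (fun p => Set.indicator (A p.1) (1 : Ω → ℝ) ω - μ (A p.1)),
    Fintype.sum_sigma] at hω
  simpa only [Finset.sum_const, Finset.card_univ, Fintype.card_fin, nsmul_eq_mul,
    Nat.cast_zero, zero_mul, sub_zero] using hω

theorem ficoh_nonneg {Ω : Type*} (𝒟 : Set (Set Ω)) (μ : Set Ω → ℝ)
    (H : ∀ (n m : ℕ) (A : Fin n → Set Ω) (A₀ : Set Ω),
          (∀ i, A i ∈ 𝒟) → A₀ ∈ 𝒟 → ∀ ε : ℝ, 0 < ε → ∃ ω : Ω,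
            (∑ i : Fin n, (Set.indicator (A i) (1 : Ω → ℝ) ω - μ (A i))) -
              (m : ℝ) * (Set.indicator A₀ (1 : Ω → ℝ) ω - μ A₀) > -ε)
    (h0 : ∅ ∈ 𝒟) (h01 : ∀ A ∈ 𝒟, 0 ≤ μ A ∧ μ A ≤ 1)
    {ι : Type*} [Fintype ι] (A : ι → Set Ω) (hA : ∀ i, A i ∈ 𝒟) (c : ι → ℝ)
    (hc : ∀ i, 0 ≤ c i) (ε : ℝ) (hε : 0 < ε) : ∃ ω : Ω,
      ∑ i, c i * (Set.indicator (A i) (1 : Ω → ℝ) ω - μ (A i)) > -ε := by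
  obtain ⟨N, hN⟩ := exists_nat_gt ((Fintype.card ι + 1 : ℝ) / ε)
  have hNpos : (0 : ℝ) < N := lt_trans (by positivity) hN
  rw [div_lt_iff₀ hε] at hN
  obtain ⟨ω, hω⟩ := ficoh_nat 𝒟 μ H h0 A hA (fun i => ⌊N * c i⌋₊) 1 one_pos
  refine ⟨ω, ?_⟩
  have key : ∑ i, ((⌊N * c i⌋₊ : ℝ) * (Set.indicator (A i) (1 : Ω → ℝ) ω - μ (A i)) - 1) ≤
      ∑ i, N * (c i * (Set.indicator (A i) (1 : Ω → ℝ) ω - μ (A i))) := by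
    refine Finset.sum_le_sum fun i _ => ?_
    have f1 := Nat.floor_le (mul_nonneg hNpos.le (hc i))
    have f2 := Nat.lt_floor_add_one (N * c i)
    obtain ⟨g1, g2⟩ := h01 _ (hA i)
    have g3 : -1 ≤ Set.indicator (A i) (1 : Ω → ℝ) ω - μ (A i) := by
      have : 0 ≤ Set.indicator (A i) (1 : Ω → ℝ) ω :=
        Set.indicator_nonneg (fun _ _ => zero_le_one) _
      linarith
    nlinarith
  rw [Finset.sum_sub_distrib, ← Finset.mul_sum] at key
  simp only [Finset.sum_const, Finset.card_univ, nsmul_eq_mul, mul_one] at key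
  have : (N : ℝ) * (-ε) <
      N * ∑ i, c i * (Set.indicator (A i) (1 : Ω → ℝ) ω - μ (A i)) := by linarith
  exact lt_of_mul_lt_mul_left this hNpos.le

open Classical in
theorem ficoh_real {Ω : Type*} (𝒟 : Set (Set Ω)) (μ : Set Ω → ℝ)
    (H : ∀ (n m : ℕ) (A : Fin n → Set Ω) (A₀ : Set Ω),
          (∀ i, A i ∈ 𝒟) → A₀ ∈ 𝒟 → ∀ ε : ℝ, 0 < ε → ∃ ω : Ω,
            (∑ i : Fin n, (Set.indicator (A i) (1 : Ω → ℝ) ω - μ (A i))) -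
              (m : ℝ) * (Set.indicator A₀ (1 : Ω → ℝ) ω - μ A₀) > -ε)
    (h𝒟 : IsPreDynkin 𝒟) (h01 : ∀ A ∈ 𝒟, 0 ≤ μ A ∧ μ A ≤ 1)
    (hcompl : ∀ A ∈ 𝒟, μ A = 1 - μ Aᶜ)
    {ι : Type*} [Fintype ι] (A : ι → Set Ω) (hA : ∀ i, A i ∈ 𝒟) (c : ι → ℝ)
    (ε : ℝ) (hε : 0 < ε) : ∃ ω : Ω,
      ∑ i, c i * (Set.indicator (A i) (1 : Ω → ℝ) ω - μ (A i)) > -ε := by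
  obtain ⟨ω, hω⟩ := ficoh_nonneg 𝒟 μ H h𝒟.1 h01 (fun i => if 0 ≤ c i then A i else (A i)ᶜ)
    (fun i => by
      split_ifs
      · exact hA i
      · exact h𝒟.2.1 _ (hA i)) (fun i => |c i|) (fun i => abs_nonneg _) ε hε
  refine ⟨ω, ?_⟩
  convert hω using 2 with i
  by_cases h : 0 ≤ c i
  · simp only [h, if_true, abs_of_nonneg]
  · simp only [h, if_false]
    rw [abs_of_neg (not_le.1 h), hcompl _ (hA i)]
    by_cases hm : ω ∈ A i <;> simp [hm] <;> ring

/-- a finitely additive probability on a pre-Dynkin-system is extendable to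
`2^Ω` iff it is a coherent additive probability on `𝒟`.  The supremum-condition
`sup_{ω∈Ω} [...] ≥ 0` is expressed as: for every `ε > 0` there is `ω` with `[...] > -ε`. -/
theorem extendable_iff_coherent {Ω : Type*} (𝒟 : Set (Set Ω)) (h𝒟 : IsPreDynkin 𝒟)
    (μ : Set Ω → ℝ) (hμ : IsFinAddProbOn 𝒟 μ) :
    (∃ ν : Set Ω → ℝ, IsFinAddProb ν ∧ ∀ A ∈ 𝒟, ν A = μ A) ↔
      ((∀ A ∈ 𝒟, μ A = 1 - μ Aᶜ) ∧
        ∀ (n m : ℕ) (A : Fin n → Set Ω) (A₀ : Set Ω),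
          (∀ i, A i ∈ 𝒟) → A₀ ∈ 𝒟 → ∀ ε : ℝ, 0 < ε → ∃ ω : Ω,
            (∑ i : Fin n, (Set.indicator (A i) (1 : Ω → ℝ) ω - μ (A i))) -
              (m : ℝ) * (Set.indicator A₀ (1 : Ω → ℝ) ω - μ A₀) > -ε) := by
  constructor
  · rintro ⟨ν, hν, hνμ⟩
    constructor
    · intro A hA
      rw [← hνμ A hA, ← hνμ _ (h𝒟.2.1 A hA), ← hν.2.2.1, ← Set.union_compl_self A,
        hν.2.2.2 A Aᶜ (Set.inter_compl_self A)]
      ring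
    · intro n m A A₀ hA hA₀ ε hε
      by_contra! hcon
      have := ficoh_integral ν hν (fun i : Option (Fin n) => i.elim A₀ A)
        (fun i => i.elim (-(m : ℝ)) (fun _ => 1)) Finset.univ Set.univ
        (-ε + ∑ i, μ (A i) - m * μ A₀) (by
          intro ω _
          have := hcon ω
          rw [Finset.sum_sub_distrib] at this
          simp only [Fintype.sum_option, Option.elim, one_mul]
          linarith)
      simp only [Fintype.sum_option, Option.elim, one_mul, Set.inter_univ, hν.2.2.1,
        hνμ _ hA₀, hνμ _ (hA _)] at this
      linarith
  · rintro ⟨hcompl, H⟩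
    let ev : (Set Ω →₀ ℝ) →ₗ[ℝ] (Ω → ℝ) :=
      Finsupp.linearCombination ℝ (fun A : Set Ω => Set.indicator A (1 : Ω → ℝ))
    have ev_single : ∀ A c, ev (Finsupp.single A c) = c • Set.indicator A (1 : Ω → ℝ) :=
      fun A c => Finsupp.linearCombination_single ℝ c A
    have ev_apply : ∀ x ω, ev x ω = ∑ A ∈ x.support, x A * Set.indicator A (1 : Ω → ℝ) ω := by
      intro x ω
      simp [ev, Finsupp.linearCombination_apply, Finsupp.sum]
    let s : PointedCone ℝ (Set Ω →₀ ℝ) := (PointedCone.positive ℝ (Ω → ℝ)).comap ev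
    have mem_s : ∀ x, x ∈ s ↔ ∀ ω, 0 ≤ ev x ω := by
      intro x
      simp [s, Pi.le_def]
    have huniv : Set.univ ∈ 𝒟 := by simpa using h𝒟.2.1 _ h𝒟.1
    let f : (Set Ω →₀ ℝ) →ₗ.[ℝ] ℝ :=
      ⟨Finsupp.supported ℝ ℝ 𝒟, (Finsupp.linearCombination ℝ μ).domRestrict _⟩
    obtain ⟨g, hg, hgs⟩ := riesz_extension s f (by
      rintro ⟨x, hx⟩ hxs
      replace hx : x ∈ Finsupp.supported ℝ ℝ 𝒟 := hx
      rw [Finsupp.mem_supported] at hx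
      change 0 ≤ Finsupp.linearCombination ℝ μ x
      rw [mem_s] at hxs
      refine le_of_forall_pos_lt_add fun ε hε => ?_
      obtain ⟨ω, hω⟩ := ficoh_real 𝒟 μ H h𝒟 hμ.1 hcompl (fun A : x.support => (A : Set Ω))
        (fun A => hx A.2) (fun A => - x A) ε hε
      have h1 := hxs ω
      rw [ev_apply] at h1
      rw [Finset.sum_coe_sort x.support
        (fun A => - x A * (Set.indicator A (1 : Ω → ℝ) ω - μ A))] at hω
      simp only [mul_sub, neg_mul, Finset.sum_sub_distrib, Finset.sum_neg_distrib] at hω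
      simp only [Finsupp.linearCombination_apply, Finsupp.sum, smul_eq_mul]
      linarith) (by
      intro y
      refine ⟨⟨Finsupp.single Set.univ (∑ A ∈ y.support, |y A|),
        Finsupp.single_mem_supported ℝ _ huniv⟩, ?_⟩
      rw [mem_s]
      intro ω
      rw [map_add, Pi.add_apply, ev_single, ev_apply y]
      simp only [Set.indicator_univ, Pi.smul_apply, Pi.one_apply, smul_eq_mul, mul_one]
      rw [← Finset.sum_add_distrib]
      refine Finset.sum_nonneg fun A _ => ?_
      by_cases h : ω ∈ A
      · simp [h]
        linarith [neg_abs_le (y A)]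
      · simp [h])
    have gμ : ∀ A ∈ 𝒟, g (Finsupp.single A 1) = μ A := by
      intro A hA
      have := hg ⟨Finsupp.single A 1, Finsupp.single_mem_supported ℝ _ hA⟩
      refine this.trans ?_
      change Finsupp.linearCombination ℝ μ (Finsupp.single A 1) = μ A
      simp
    have gle : ∀ x y, (∀ ω, ev x ω ≤ ev y ω) → g x ≤ g y := by
      intro x y h
      have := hgs (y - x) (by
        rw [mem_s]
        intro ω
        rw [map_sub, Pi.sub_apply]
        linarith [h ω])
      rw [map_sub] at this
      linarith
    refine ⟨fun A => g (Finsupp.single A 1), ⟨?_, ?_, ?_, ?_⟩, gμ⟩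
    · intro A
      constructor
      · rw [← map_zero g]
        refine gle _ _ fun ω => ?_
        rw [ev_single, map_zero]
        by_cases h : ω ∈ A <;> simp [h]
      · refine le_trans ?_ ((gμ _ huniv).trans hμ.2.2.1).le
        refine gle _ _ fun ω => ?_
        rw [ev_single, ev_single]
        by_cases h : ω ∈ A <;> simp [h]
    · exact (gμ _ h𝒟.1).trans hμ.2.1
    · exact (gμ _ huniv).trans hμ.2.2.1
    · intro A B hAB
      have e : ev (Finsupp.single (A ∪ B) 1) = ev (Finsupp.single A 1 + Finsupp.single B 1) := by
        rw [map_add, ev_single, ev_single, ev_single,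
          Set.indicator_union_of_disjoint (Set.disjoint_iff_inter_eq_empty.2 hAB)]
        ext ω
        simp
      rw [← map_add]
      exact le_antisymm (gle _ _ fun ω => by rw [e]) (gle _ _ fun ω => by rw [e])
end

section
/- Fix a finitely additive probability ψ on 2^Ω, let Δ be the set of all finitely additive probabilities on 2^Ω, and let m°(Q) = {A ⊆ Ω : ν(A) = ψ(A) for all ν ∈ Q} for Q ⊆ Δ. Then for every nonempty Q ⊆ Δ, the set m°(Q) is a pre-Dynkin-system on Ω. -/
/-- The pre-Dynkin hull `D(𝒜)`: the smallest pre-Dynkin-system containing `𝒜`. -/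
def preDynkinHull {Ω : Type*} (𝒜 : Set (Set Ω)) : Set (Set Ω) :=
  ⋂₀ {𝒟 | IsPreDynkin 𝒟 ∧ 𝒜 ⊆ 𝒟}

/-- The credal set function `m` with respect to a reference probability `ψ`. -/
def credal {Ω : Type*} (ψ : Set Ω → ℝ) (𝒜 : Set (Set Ω)) : Set (Set Ω → ℝ) :=
  {ν | IsFinAddProb ν ∧ ∀ A ∈ 𝒜, ν A = ψ A}

/-- The dual credal set function `m°` with respect to a reference probability `ψ`. -/
def dualCredal {Ω : Type*} (ψ : Set Ω → ℝ) (Q : Set (Set Ω → ℝ)) : Set (Set Ω) :=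
  {A | ∀ ν ∈ Q, ν A = ψ A}

/-- the dual credal set function maps nonempty sets of finitely additive
probabilities to pre-Dynkin-systems. -/
theorem dualCredal_isPreDynkin {Ω : Type*} (ψ : Set Ω → ℝ) (hψ : IsFinAddProb ψ)
    (Q : Set (Set Ω → ℝ)) (hQ : ∀ ν ∈ Q, IsFinAddProb ν) (hQne : Q.Nonempty) :
    IsPreDynkin (dualCredal ψ Q) := by
  obtain ⟨-, h0, h1, hadd⟩ := hψ
  refine ⟨?_, ?_, ?_⟩
  · intro ν hν
    rw [(hQ ν hν).2.1, h0]
  · intro A hA ν hν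
    obtain ⟨-, -, k1, kadd⟩ := hQ ν hν
    have e1 := kadd A Aᶜ (Set.inter_compl_self A)
    have e2 := hadd A Aᶜ (Set.inter_compl_self A)
    rw [Set.union_compl_self] at e1 e2
    have e3 : ν A = ψ A := hA ν hν
    linarith
  · intro A hA B hB hAB ν hν
    have e1 : ν A = ψ A := hA ν hν
    have e2 : ν B = ψ B := hB ν hν
    rw [(hQ ν hν).2.2.2 A B hAB, hadd A B hAB, e1, e2]
end

section
/- Fix a finitely additive probability ψ on 2^Ω, let Δ be the set of all finitely additive probabilities on 2^Ω, let m(𝒜) = {ν ∈ Δ : ν(A) = ψ(A) for all A ∈ 𝒜} and m°(Q) = {A ⊆ Ω : ν(A) = ψ(A) for all ν ∈ Q}. For every 𝒜 ⊆ 2^Ω, the pre-Dynkin hull D(𝒜) (the smallest pre-Dynkin-system on Ω containing 𝒜) satisfies D(𝒜) ⊆ m°(m(𝒜)). -/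
/-- the pre-Dynkin hull is contained in the bipolar closure. -/
theorem preDynkinHull_subset_bipolar {Ω : Type*} (ψ : Set Ω → ℝ) (hψ : IsFinAddProb ψ)
    (𝒜 : Set (Set Ω)) :
    preDynkinHull 𝒜 ⊆ dualCredal ψ (credal ψ 𝒜) := by
  have compl : ∀ ν : Set Ω → ℝ, IsFinAddProb ν → ∀ A, ν Aᶜ = 1 - ν A := by
    intro ν hν A
    have h := hν.2.2.2 A Aᶜ (Set.inter_compl_self A)
    rw [Set.union_compl_self, hν.2.2.1] at h
    linarith
  apply Set.sInter_subset_of_mem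
  refine ⟨⟨?_, ?_, ?_⟩, ?_⟩
  · intro ν hν
    rw [hν.1.2.1, hψ.2.1]
  · intro A hA ν hν
    rw [compl ν hν.1, compl ψ hψ, hA ν hν]
  · intro A hA B hB hAB ν hν
    rw [hν.1.2.2.2 A B hAB, hψ.2.2.2 A B hAB, hA ν hν, hB ν hν]
  · intro A hA ν hν
    exact hν.2 A hA
end

section
/- Fix a finitely additive probability ψ on 2^Ω, let Δ be the set of all finitely additive probabilities on 2^Ω, let m(𝒜) = {ν ∈ Δ : ν(A) = ψ(A) for all A ∈ 𝒜} and m°(Q) = {A ⊆ Ω : ν(A) = ψ(A) for all ν ∈ Q}. Let 𝒜 ⊆ 2^Ω. For any A ∈ m°(m(𝒜)) with ψ(A) = 0: every B ⊆ A and every C ⊇ Ω∖A belong to m°(m(𝒜)). -/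
/-- "closedness" of the bipolar closure under measure-zero sets. -/
theorem bipolar_closed_under_null_sets {Ω : Type*} (ψ : Set Ω → ℝ) (hψ : IsFinAddProb ψ)
    (𝒜 : Set (Set Ω)) (A : Set Ω)
    (hA : A ∈ dualCredal ψ (credal ψ 𝒜)) (hA0 : ψ A = 0) :
    ∀ B C : Set Ω, B ⊆ A → Aᶜ ⊆ C →
      B ∈ dualCredal ψ (credal ψ 𝒜) ∧ C ∈ dualCredal ψ (credal ψ 𝒜) := by
  have null : ∀ ν : Set Ω → ℝ, IsFinAddProb ν → ν A = 0 → ∀ B, B ⊆ A → ν B = 0 := by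
    intro ν h h0 B hB
    have h1 := h.2.2.2 B (A \ B) (by simp)
    rw [Set.union_diff_cancel hB] at h1
    linarith [(h.1 B).1, (h.1 (A \ B)).1]
  have compl : ∀ ν : Set Ω → ℝ, IsFinAddProb ν → ∀ C, ν C + ν Cᶜ = 1 := by
    intro ν h C
    have h1 := h.2.2.2 C Cᶜ (by simp)
    rw [Set.union_compl_self, h.2.2.1] at h1
    exact h1.symm
  intro B C hB hC
  have hC' : Cᶜ ⊆ A := Set.compl_subset_comm.mp hC
  refine ⟨fun ν hν => ?_, fun ν hν => ?_⟩
  · rw [null ν hν.1 ((hA ν hν).trans hA0) B hB, null ψ hψ hA0 B hB]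
  · have a := null ν hν.1 ((hA ν hν).trans hA0) _ hC'
    have b := null ψ hψ hA0 _ hC'
    linarith [compl ν hν.1 C, compl ψ hψ C]
end
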